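/- arXiv:1910.14467 — 3 statements merged into one kernel-verified Lean document; each statement's English description precedes it below -/
import Mathlib

section
/- Let D be a convex subset of ℝⁿ, let f_vex : ℝⁿ → ℝ be any function, and let f_cav : ℝⁿ → ℝ be concave on D and differentiable, with gradient ∇f_cav. Suppose a sequence (u⁽ᵗ⁾)_{t≥0} of points of D satisfies, for every t, that u⁽ᵗ⁺¹⁾ minimizes over D the function u ↦ f_vex(u) + f_cav(u⁽ᵗ⁾) + ⟨∇f_cav(u⁽ᵗ⁾), u − u⁽ᵗ⁾⟩. Then the sequence is monotone for the objective f = f_vex + f_cav, i.e. f(u⁽ᵗ⁺¹⁾) ≤ f(u⁽ᵗ⁾) for all t ≥ 0. -/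
open Filter RealInnerProductSpace

/-- A concave function lies below its linearization at a point of the set. -/
theorem ConcaveOn.le_add_inner_of_hasGradientAt {E : Type*} [NormedAddCommGroup E]
    [InnerProductSpace ℝ E] [CompleteSpace E] {s : Set E} {f : E → ℝ} {f' x y : E}
    (hf : ConcaveOn ℝ s f) (hx : x ∈ s) (hy : y ∈ s) (hf' : HasGradientAt f f' x) :
    f y ≤ f x + ⟪f', y - x⟫ := by
  have hline : HasDerivAt (AffineMap.lineMap x y : ℝ → E) (y - x) 0 :=
    AffineMap.hasDerivAt_lineMap
  have hderiv : HasDerivAt (f ∘ (AffineMap.lineMap x y : ℝ → E)) ⟪f', y - x⟫ 0 := by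
    have hfx : HasFDerivAt f (InnerProductSpace.toDual ℝ E f') (AffineMap.lineMap x y (0 : ℝ)) := by
      simpa using hf'.hasFDerivAt
    simpa using hfx.comp_hasDerivAt (0 : ℝ) hline
  have hslope := (hf.comp_affineMap (AffineMap.lineMap x y)).slope_le_of_hasDerivAt
    (x := 0) (y := 1) (by simpa using hx) (by simpa using hy) one_pos hderiv
  simp only [slope_def_field, Function.comp_apply, AffineMap.lineMap_apply_zero,
    AffineMap.lineMap_apply_one, sub_zero, div_one] at hslope
  linarith

/-- Descent property of the Concave-Convex Procedure (CCCP): if `f_cav` is concave on the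
convex set `D` and differentiable with gradient `g`, and each iterate `u (t+1)` minimizes over
`D` the convex proxy obtained by linearizing the concave part at `u t`, then the objective
`f = f_vex + f_cav` is nonincreasing along the iterates. -/
theorem cccp_descent {n : ℕ} (D : Set (EuclideanSpace ℝ (Fin n))) (hD : Convex ℝ D)
    (f_vex f_cav : EuclideanSpace ℝ (Fin n) → ℝ)
    (g : EuclideanSpace ℝ (Fin n) → EuclideanSpace ℝ (Fin n))
    (hcav : ConcaveOn ℝ D f_cav)
    (hdiff : ∀ x, HasGradientAt f_cav (g x) x)
    (u : ℕ → EuclideanSpace ℝ (Fin n))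
    (hmem : ∀ t, u t ∈ D)
    (hmin : ∀ t, IsMinOn (fun v => f_vex v + f_cav (u t) + ⟪g (u t), v - u t⟫) D (u (t + 1))) :
    ∀ t, f_vex (u (t + 1)) + f_cav (u (t + 1)) ≤ f_vex (u t) + f_cav (u t) := by
  intro t
  have hlin := hcav.le_add_inner_of_hasGradientAt (hmem t) (hmem (t + 1)) (hdiff (u t))
  have hle := isMinOn_iff.mp (hmin t) (u t) (hmem t)
  simp only [sub_self, inner_zero_right, add_zero] at hle
  linarith
end

section
/- Let Ψ₁ and Ψ₂ be M×M complex Hermitian positive definite matrices and define the Bregman divergence D(Ψ₁, Ψ₂) = log(Re(det Ψ₂)) − log(Re(det Ψ₁)) + Re(tr(Ψ₂⁻¹ Ψ₁)) − M. Then D(Ψ₁, Ψ₂) ≥ 0, with equality if and only if Ψ₁ = Ψ₂. -/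
open Matrix
open scoped ComplexOrder

namespace Matrix.PosDef

variable {n : Type*} [Fintype n] [DecidableEq n] {A B : Matrix n n ℂ}

lemma re_det_pos (hA : A.PosDef) : 0 < A.det.re :=
  (Complex.lt_def.mp hA.det_pos).1

lemma ofReal_re_det (hA : A.PosDef) : (A.det.re : ℂ) = A.det :=
  (Complex.eq_re_of_ofReal_le hA.det_pos.le).symm

lemma re_trace_sub_card_sub_log_re_det (hA : A.PosDef) :
    A.trace.re - Fintype.card n - Real.log A.det.re =
      ∑ i, (hA.1.eigenvalues i - 1 - Real.log (hA.1.eigenvalues i)) := by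
  have htr : A.trace.re = ∑ i, hA.1.eigenvalues i := by
    rw [hA.1.trace_eq_sum_eigenvalues]
    simp
  have hdet : A.det.re = ∏ i, hA.1.eigenvalues i := by
    rw [hA.1.det_eq_prod_eigenvalues]
    exact_mod_cast Complex.ofReal_re _
  rw [htr, hdet, Real.log_prod fun i _ ↦ (hA.eigenvalues_pos i).ne']
  simp [Finset.sum_sub_distrib]

lemma eigenvalue_sub_one_sub_log_nonneg (hA : A.PosDef) (i : n) :
    0 ≤ hA.1.eigenvalues i - 1 - Real.log (hA.1.eigenvalues i) :=
  sub_nonneg.mpr (Real.log_le_sub_one_of_pos (hA.eigenvalues_pos i))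

lemma re_trace_sub_card_sub_log_re_det_nonneg (hA : A.PosDef) :
    0 ≤ A.trace.re - Fintype.card n - Real.log A.det.re := by
  rw [hA.re_trace_sub_card_sub_log_re_det]
  exact Finset.sum_nonneg fun i _ ↦ hA.eigenvalue_sub_one_sub_log_nonneg i

lemma re_trace_sub_card_sub_log_re_det_eq_zero_iff (hA : A.PosDef) :
    A.trace.re - Fintype.card n - Real.log A.det.re = 0 ↔ A = 1 := by
  refine ⟨fun h ↦ ?_, fun h ↦ by simp [h]⟩
  rw [hA.re_trace_sub_card_sub_log_re_det,
    Finset.sum_eq_zero_iff_of_nonneg fun i _ ↦ hA.eigenvalue_sub_one_sub_log_nonneg i] at h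
  have hone : hA.1.eigenvalues = fun _ ↦ 1 := by
    funext i
    by_contra hi
    have hlt := Real.log_lt_sub_one_of_pos (hA.eigenvalues_pos i) hi
    linarith [h i (Finset.mem_univ i)]
  have hdiag : diagonal (RCLike.ofReal ∘ hA.1.eigenvalues : n → ℂ) = 1 := by
    rw [hone, ← diagonal_one]
    congr 1
  rw [hA.1.spectral_theorem, hdiag, map_one]

open scoped MatrixOrder in
lemma exists_isUnit_inv_eq_star_mul_self (hB : B.PosDef) :
    ∃ C : Matrix n n ℂ, IsUnit C ∧ B⁻¹ = star C * C := by
  obtain ⟨C, hC⟩ := CStarAlgebra.nonneg_iff_eq_star_mul_self.mp hB.inv.posSemidef.nonneg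
  refine ⟨C, ?_, hC⟩
  have hu : IsUnit (star C * C) := hC ▸ hB.inv.isUnit
  rw [isUnit_iff_isUnit_det, det_mul] at hu
  exact (isUnit_iff_isUnit_det C).mpr (isUnit_of_mul_isUnit_right hu)

/-- Some positive definite congruence transform of `A` has the trace and
determinant of `B⁻¹ * A`, and is the identity exactly when `A = B`. -/
lemma exists_posDef_trace_det_inv_mul (hA : A.PosDef) (hB : B.PosDef) :
    ∃ P : Matrix n n ℂ, P.PosDef ∧ P.trace = (B⁻¹ * A).trace ∧ P.det = (B⁻¹ * A).det ∧
      (P = 1 ↔ A = B) := by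
  obtain ⟨C, hC, hCB⟩ := hB.exists_isUnit_inv_eq_star_mul_self
  have hBu : IsUnit B.det := (isUnit_iff_isUnit_det B).mp hB.isUnit
  refine ⟨C * A * star C, hC.posDef_star_right_conjugate_iff.mpr hA, ?_, ?_, ?_⟩
  · rw [hCB, trace_mul_cycle]
  · rw [hCB]
    simp only [det_mul]
    ring
  · rw [mul_eq_one_comm, ← mul_assoc, ← hCB]
    refine ⟨fun h ↦ ?_, fun h ↦ by rw [h, nonsing_inv_mul B hBu]⟩
    rw [← mul_one B, ← h, mul_nonsing_inv_cancel_left B A hBu]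

lemma log_re_det_inv_mul (hA : A.PosDef) (hB : B.PosDef) :
    Real.log (B⁻¹ * A).det.re = Real.log A.det.re - Real.log B.det.re := by
  have h : (B⁻¹ * A).det = ((A.det.re / B.det.re : ℝ) : ℂ) := by
    rw [det_mul, det_nonsing_inv, Ring.inverse_eq_inv', Complex.ofReal_div, hA.ofReal_re_det,
      hB.ofReal_re_det, div_eq_inv_mul]
  rw [h, Complex.ofReal_re, Real.log_div hA.re_det_pos.ne' hB.re_det_pos.ne']

end Matrix.PosDef

/-- Nonnegativity of the Bregman divergence generated by `−log det` on Hermitian positive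
definite complex matrices:
`D(Ψ₁, Ψ₂) = log Re det Ψ₂ − log Re det Ψ₁ + Re tr(Ψ₂⁻¹ Ψ₁) − M ≥ 0`, with equality iff
`Ψ₁ = Ψ₂`. -/
theorem bregman_logdet_nonneg {M : ℕ} (Ψ₁ Ψ₂ : Matrix (Fin M) (Fin M) ℂ)
    (h₁ : Ψ₁.PosDef) (h₂ : Ψ₂.PosDef) :
    0 ≤ Real.log Ψ₂.det.re - Real.log Ψ₁.det.re + ((Ψ₂⁻¹ * Ψ₁).trace).re - (M : ℝ) ∧
    (Real.log Ψ₂.det.re - Real.log Ψ₁.det.re + ((Ψ₂⁻¹ * Ψ₁).trace).re - (M : ℝ) = 0 ↔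
      Ψ₁ = Ψ₂) := by
  obtain ⟨P, hP, htr, hdet, hone⟩ := h₁.exists_posDef_trace_det_inv_mul h₂
  have hD : Real.log Ψ₂.det.re - Real.log Ψ₁.det.re + ((Ψ₂⁻¹ * Ψ₁).trace).re - (M : ℝ) =
      P.trace.re - Fintype.card (Fin M) - Real.log P.det.re := by
    rw [htr, hdet, h₁.log_re_det_inv_mul h₂, Fintype.card_fin]
    ring
  rw [hD, ← hone]
  exact ⟨hP.re_trace_sub_card_sub_log_re_det_nonneg,
    hP.re_trace_sub_card_sub_log_re_det_eq_zero_iff⟩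
end

section
/- Let ν be a nonzero finite Borel measure on ℝ whose support is contained in [0, C] for some C > 0 with ν((0, C]) > 0, and let ζ > 0. Define φ(ω) = ω·(1 − ζ·∫ λ/(λ − ω) dν(λ)) for ω > C. If ω₀ ∈ (C, ∞) is a local minimizer of φ on (C, ∞), then ω₀ is the unique global minimizer of φ on (C, ∞), and it satisfies the first-order condition ∫ λ²/(ω₀ − λ)² dν(λ) = 1/ζ. -/
open MeasureTheory Filter Set

theorem integrable_of_continuousOn_Icc {ν : Measure ℝ} [IsFiniteMeasure ν] {a b : ℝ}
    (hν : ∀ᵐ x ∂ν, x ∈ Icc a b) {f : ℝ → ℝ} (hf : ContinuousOn f (Icc a b)) :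
    Integrable f ν := by
  rw [← Measure.restrict_eq_self_of_ae_mem hν]
  exact hf.integrableOn_compact isCompact_Icc

/-- Second-order expansion of `φ` around `v`, with exact remainder. -/
theorem phi_sub_phi_eq {ν : Measure ℝ} [IsFiniteMeasure ν] {C : ℝ}
    (hν : ∀ᵐ x ∂ν, x ∈ Icc 0 C) (ζ : ℝ) {v w : ℝ} (hv : C < v) (hw : C < w) :
    w * (1 - ζ * ∫ x, x / (x - w) ∂ν) - v * (1 - ζ * ∫ x, x / (x - v) ∂ν) =
      (w - v) * (1 - ζ * ∫ x, x ^ 2 / (v - x) ^ 2 ∂ν) +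
        ζ * (w - v) ^ 2 * ∫ x, x ^ 2 / ((w - x) * (v - x) ^ 2) ∂ν := by
  have sub_ne {u : ℝ} (hu : C < u) : ∀ x ∈ Icc 0 C, x - u ≠ 0 := fun x hx =>
    (sub_neg.2 (hx.2.trans_lt hu)).ne
  have sub_ne' {u : ℝ} (hu : C < u) : ∀ x ∈ Icc 0 C, u - x ≠ 0 := fun x hx =>
    (sub_pos.2 (hx.2.trans_lt hu)).ne'
  have int_div {u : ℝ} (hu : C < u) : Integrable (fun x => x / (x - u)) ν :=
    integrable_of_continuousOn_Icc hν (ContinuousOn.div (by fun_prop) (by fun_prop) (sub_ne hu))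
  have int_sq : Integrable (fun x => x ^ 2 / (v - x) ^ 2) ν :=
    integrable_of_continuousOn_Icc hν (ContinuousOn.div (by fun_prop) (by fun_prop)
      fun x hx => pow_ne_zero 2 (sub_ne' hv x hx))
  have int_rem : Integrable (fun x => x ^ 2 / ((w - x) * (v - x) ^ 2)) ν :=
    integrable_of_continuousOn_Icc hν (ContinuousOn.div (by fun_prop) (by fun_prop)
      fun x hx => mul_ne_zero (sub_ne' hw x hx) (pow_ne_zero 2 (sub_ne' hv x hx)))
  have key : v * (∫ x, x / (x - v) ∂ν) - w * (∫ x, x / (x - w) ∂ν) =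
      (w - v) ^ 2 * (∫ x, x ^ 2 / ((w - x) * (v - x) ^ 2) ∂ν) -
        (w - v) * ∫ x, x ^ 2 / (v - x) ^ 2 ∂ν := by
    simp only [← integral_const_mul]
    rw [← integral_sub ((int_div hv).const_mul _) ((int_div hw).const_mul _),
      ← integral_sub (int_rem.const_mul _) (int_sq.const_mul _)]
    refine integral_congr_ae ?_
    filter_upwards [hν] with x hx
    have h₁ := sub_ne' hv x hx
    have h₂ := sub_ne' hw x hx
    rw [← neg_sub v x, ← neg_sub w x]
    field_simp
    ring
  linear_combination ζ * key

/-- Any local minimizer `ω₀` on `(C, ∞)` of `φ(ω) = ω(1 − ζ ∫ λ/(λ−ω) dν(λ))` is its unique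
global minimizer there, and satisfies the first-order condition
`∫ λ²/(ω₀−λ)² dν(λ) = 1/ζ`. -/
theorem phi_localMin_is_unique_global (ν : Measure ℝ) [IsFiniteMeasure ν] (hν : ν ≠ 0)
    (C : ℝ) (hC : 0 < C) (hsupp : ν (Set.Icc 0 C)ᶜ = 0)
    (hmass : 0 < ν (Set.Ioc 0 C))
    (ζ : ℝ) (hζ : 0 < ζ) (ω₀ : ℝ) (hω₀ : ω₀ ∈ Set.Ioi C)
    (hmin : IsLocalMinOn (fun w : ℝ => w * (1 - ζ * ∫ x, x / (x - w) ∂ν)) (Set.Ioi C) ω₀) :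
    (∀ ω ∈ Set.Ioi C, ω ≠ ω₀ →
      ω₀ * (1 - ζ * ∫ x, x / (x - ω₀) ∂ν) < ω * (1 - ζ * ∫ x, x / (x - ω) ∂ν)) ∧
    (∫ x, x ^ 2 / (ω₀ - x) ^ 2 ∂ν) = 1 / ζ := by
  have hae : ∀ᵐ x ∂ν, x ∈ Icc 0 C := hsupp
  have hC₀ : C < ω₀ := hω₀
  have int_rem {w : ℝ} (hw : C < w) :
      Integrable (fun x => x ^ 2 / ((w - x) * (ω₀ - x) ^ 2)) ν :=
    integrable_of_continuousOn_Icc hae (ContinuousOn.div (by fun_prop) (by fun_prop)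
      fun x hx => mul_ne_zero (sub_pos.2 (hx.2.trans_lt hw)).ne'
        (pow_ne_zero 2 (sub_pos.2 (hx.2.trans_lt hC₀)).ne'))
  have foc : 1 - ζ * ∫ x, x ^ 2 / (ω₀ - x) ^ 2 ∂ν = 0 := by
    set c := 1 - ζ * ∫ x, x ^ 2 / (ω₀ - x) ^ 2 ∂ν
    obtain ⟨m, hCm, hm⟩ := exists_between hC₀
    set K := ∫ x, x ^ 2 / ((m - x) * (ω₀ - x) ^ 2) ∂ν
    have hloc : IsLocalMin (fun w : ℝ => (w - ω₀) * c + ζ * (w - ω₀) ^ 2 * K) ω₀ := by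
      filter_upwards [hmin.isLocalMin (Ioi_mem_nhds hC₀), Ioi_mem_nhds hm] with w hw hmw
      have hmw : m < w := hmw
      have hle : ∫ x, x ^ 2 / ((w - x) * (ω₀ - x) ^ 2) ∂ν ≤ K := by
        refine integral_mono_ae (int_rem (hCm.trans hmw)) (int_rem hCm) ?_
        filter_upwards [hae] with x hx
        have h₁ : 0 < m - x := sub_pos.2 (hx.2.trans_lt hCm)
        have h₂ : 0 < ω₀ - x := sub_pos.2 (hx.2.trans_lt hC₀)
        gcongr
      have hexp := phi_sub_phi_eq hae ζ hC₀ (hCm.trans hmw)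
      have := mul_le_mul_of_nonneg_left hle (mul_nonneg hζ.le (sq_nonneg (w - ω₀)))
      simp only [sub_self, zero_mul, ne_eq, OfNat.ofNat_ne_zero, not_false_eq_true, zero_pow,
        mul_zero, add_zero]
      linarith
    have hder : HasDerivAt (fun w : ℝ => (w - ω₀) * c + ζ * (w - ω₀) ^ 2 * K) c ω₀ := by
      have h := (hasDerivAt_id ω₀).sub_const ω₀
      exact ((h.mul_const c).add (((h.pow 2).const_mul ζ).mul_const K)).congr_deriv (by simp)
    exact hloc.hasDerivAt_eq_zero hder
  refine ⟨fun ω hω hne => ?_, by field_simp; linarith⟩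
  have hω : C < ω := hω
  have hpos : 0 < ∫ x, x ^ 2 / ((ω - x) * (ω₀ - x) ^ 2) ∂ν := by
    have sub_pos' {u : ℝ} (hu : C < u) {x : ℝ} (hx : x ≤ C) : 0 < u - x :=
      sub_pos.2 (hx.trans_lt hu)
    rw [integral_pos_iff_support_of_nonneg_ae ?_ (int_rem hω)]
    · refine hmass.trans_le (measure_mono fun x hx => ?_)
      have h₁ := sub_pos' hω hx.2
      have h₂ := sub_pos' hC₀ hx.2
      have h₃ : 0 < x := hx.1
      exact (show 0 < x ^ 2 / ((ω - x) * (ω₀ - x) ^ 2) by positivity).ne'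
    · filter_upwards [hae] with x hx
      have h₁ := sub_pos' hω hx.2
      dsimp only [Pi.zero_apply]
      positivity
  have hexp := phi_sub_phi_eq hae ζ hC₀ hω
  rw [foc, mul_zero, zero_add] at hexp
  have : 0 < (ω - ω₀) ^ 2 := by have := sub_ne_zero.2 hne; positivity
  have := mul_pos (mul_pos hζ this) hpos
  linarith
end
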